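/- (Drift condition for the diffusion map, dimension one.) Let U : ℝ → [1, ∞) be twice continuously differentiable with m := sup_x |U''(x)| < ∞, and suppose there exist λ₀ > 0 and R > 0 such that (1/2)U'(x)² ≥ λ₀ U(x) + m for all |x| ≥ R. Let ε ∈ (0, 1/(4m)) and define T_ε f(x) = (∫ g_ε(x−y) e^{−U(y)} f(y) dy) / (∫ g_ε(x−y) e^{−U(y)} dy), where g_ε(z) = exp(−z²/(4ε)). Then T_ε U(x) ≤ (1 − ελ₀) U(x) + ε b₀ · 1_{|x| ≤ R}(x) for all x ∈ ℝ, where b₀ = m + max_{|x| ≤ R} (λ₀ U(x) − (1/2)U'(x)²). -/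

import Mathlib

open MeasureTheory ProbabilityTheory

open scoped NNReal

/-- A real function with second derivative at most `m` lies below its quadratic Taylor majorant. -/
lemma le_add_deriv_mul_add_sq_of_deriv2_le {U : ℝ → ℝ} {m : ℝ} (hU : ContDiff ℝ 2 U)
    (hm : ∀ x, deriv (deriv U) x ≤ m) (x y : ℝ) :
    U y ≤ U x + deriv U x * (y - x) + m / 2 * (y - x) ^ 2 := by
  have hd : Differentiable ℝ U := hU.differentiable (by norm_num)
  have hd' : Differentiable ℝ (deriv U) := by
    have : ContDiff ℝ 1 (deriv U) := (contDiff_succ_iff_deriv (n := 1).1 hU).2.2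
    exact this.differentiable (by norm_num)
  set h : ℝ → ℝ := fun z => U x + deriv U x * (z - x) + m / 2 * (z - x) ^ 2 - U z with hh
  have h1 : ∀ z, HasDerivAt h (deriv U x + m * (z - x) - deriv U z) z := fun z => by
    have e : HasDerivAt (fun z : ℝ => z - x) 1 z := (hasDerivAt_id z).sub_const x
    refine (((e.const_mul (deriv U x)).const_add (U x)).add
      ((e.pow 2).const_mul (m / 2))).sub (hd z).hasDerivAt |>.congr_deriv ?_
    norm_num
    ring
  have h1' : deriv h = fun z => deriv U x + m * (z - x) - deriv U z :=
    funext fun z => (h1 z).deriv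
  have h2 : ∀ z, HasDerivAt (deriv h) (m - deriv (deriv U) z) z := fun z => by
    rw [h1']
    have e : HasDerivAt (fun z : ℝ => z - x) 1 z := (hasDerivAt_id z).sub_const x
    exact (((e.const_mul m).const_add (deriv U x)).sub (hd' z).hasDerivAt).congr_deriv (by ring)
  have hconv : ConvexOn ℝ Set.univ h :=
    convexOn_univ_of_deriv2_nonneg (fun z => (h1 z).differentiableAt)
      (fun z => (h2 z).differentiableAt) fun z => by
        rw [Function.iterate_succ_apply, Function.iterate_one, (h2 z).deriv]
        linarith [hm z]
  have hmin : IsMinOn h Set.univ x :=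
    hconv.isMinOn_of_rightDeriv_eq_zero (by simp) (by
      rw [(h1 x).hasDerivWithinAt.derivWithin (uniqueDiffWithinAt_Ioi x)]; ring)
  have := hmin (Set.mem_univ y)
  simp only [hh, Set.mem_ofPred_eq] at this
  linarith

lemma integral_sub_const_sq_gaussianReal (μ c : ℝ) (v : ℝ≥0) :
    ∫ y, (y - c) ^ 2 ∂gaussianReal μ v = v + (μ - c) ^ 2 := by
  have hL := memLp_id_gaussianReal (μ := μ) (v := v) 2
  have h1 : Integrable (fun y : ℝ => y) (gaussianReal μ v) := hL.integrable (by norm_num)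
  have h2 : Integrable (fun y : ℝ => y ^ 2) (gaussianReal μ v) := hL.integrable_sq
  have hsq : ∫ y, y ^ 2 ∂gaussianReal μ v = v + μ ^ 2 := by
    have := variance_eq_sub hL
    rw [variance_id_gaussianReal] at this
    simp only [Pi.pow_apply, id_eq, integral_id_gaussianReal] at this
    linarith
  have : ∀ y : ℝ, (y - c) ^ 2 = y ^ 2 - 2 * c * y + c ^ 2 := fun y => by ring
  simp_rw [this]
  have h3 : Integrable (fun y : ℝ => y ^ 2 - 2 * c * y) (gaussianReal μ v) :=
    h2.sub (h1.const_mul _)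
  rw [integral_add h3 (integrable_const _), integral_sub h2 (h1.const_mul _), integral_const_mul, hsq, integral_id_gaussianReal]
  simp
  ring

lemma integrable_sub_const_sq_gaussianReal (μ c : ℝ) (v : ℝ≥0) :
    Integrable (fun y : ℝ => (y - c) ^ 2) (gaussianReal μ v) :=
  ((memLp_id_gaussianReal (μ := μ) (v := v) 2).sub (memLp_const c)).integrable_sq

section Gibbs

variable {Ω : Type*} [MeasurableSpace Ω] {P : Measure Ω} {U : Ω → ℝ}

lemma integrable_exp_neg_of_nonneg [IsFiniteMeasure P] (hU : Measurable U) (hU0 : ∀ y, 0 ≤ U y) :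
    Integrable (fun y => Real.exp (-U y)) P :=
  .of_bound (by fun_prop) 1 (.of_forall fun y => by simpa using hU0 y)

/-- The mean of `U` under the Gibbs measure `e^{-U} P / Z` is at most `-log Z`. -/
lemma integral_exp_neg_mul_div_le_neg_log [IsProbabilityMeasure P] (hU : Measurable U)
    (hU0 : ∀ y, 0 ≤ U y) :
    (∫ y, Real.exp (-U y) * U y ∂P) / (∫ y, Real.exp (-U y) ∂P)
      ≤ -Real.log (∫ y, Real.exp (-U y) ∂P) := by
  have hi := integrable_exp_neg_of_nonneg (P := P) hU hU0
  have hi' : Integrable (fun y => Real.exp (-U y) * U y) P :=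
    .of_bound (by fun_prop) 1 (.of_forall fun y => by
      rw [Real.norm_of_nonneg (mul_nonneg (Real.exp_pos _).le (hU0 y)), Real.exp_neg,
        inv_mul_le_iff₀ (Real.exp_pos _)]
      linarith [Real.add_one_le_exp (U y)])
  set Z := ∫ y, Real.exp (-U y) ∂P with hZ
  have hZ0 : 0 < Z := integral_exp_pos hi
  have key : ∫ y, (Real.exp (-U y) * U y + Real.log Z * Real.exp (-U y)) ∂P
      ≤ ∫ y, (Z - Real.exp (-U y)) ∂P := by
    refine integral_mono (hi'.add (hi.const_mul _)) ((integrable_const _).sub hi) fun y => ?_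
    have h := Real.add_one_le_exp (Real.log Z + U y)
    have e : Real.exp (-U y) * Real.exp (Real.log Z + U y) = Z := by
      rw [← Real.exp_add, neg_add_cancel_comm_assoc, Real.exp_log hZ0]
    have := mul_le_mul_of_nonneg_left h (Real.exp_pos (-U y)).le
    simp only
    linarith
  rw [integral_add hi' (hi.const_mul _), integral_sub (integrable_const _) hi,
    integral_const_mul, ← hZ] at key
  simp only [integral_const, probReal_univ, one_smul, sub_self] at key
  rw [div_le_iff₀ hZ0]
  linarith

/-- Jensen inequality for the exponential. -/
lemma exp_integral_le_integral_exp [IsProbabilityMeasure P] {f : Ω → ℝ} (hf : Integrable f P)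
    (hexp : Integrable (fun y => Real.exp (f y)) P) :
    Real.exp (∫ y, f y ∂P) ≤ ∫ y, Real.exp (f y) ∂P :=
  convexOn_exp.map_integral_le Real.continuous_exp.continuousOn isClosed_univ (by simp) hf hexp

end Gibbs

lemma integral_gaussianReal_eq_integral_exp (μ c : ℝ) {v : ℝ≥0} (hv : v ≠ 0) (f : ℝ → ℝ) :
    ∫ y, f y ∂gaussianReal μ v
      = ∫ y, Real.exp (((μ - c) * (y - c) - (μ - c) ^ 2 / 2) / v) * f y ∂gaussianReal c v := by
  rw [integral_gaussianReal_eq_integral_smul hv, integral_gaussianReal_eq_integral_smul hv]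
  refine integral_congr_ae (.of_forall fun y => ?_)
  have hv' : (v : ℝ) ≠ 0 := by exact_mod_cast hv
  simp only [gaussianPDFReal, smul_eq_mul]
  rw [mul_assoc _ _ (f y), mul_assoc _ _ (_ * f y), ← mul_assoc (Real.exp _) (Real.exp _),
    ← Real.exp_add]
  congr 3
  field_simp
  ring

/-- Upper bound on the free energy `-log ∫ e^{-U} dN(x, v)`, obtained from the Gibbs variational
principle with the trial measure `N(x - v deriv U x, v)`. -/
lemma neg_log_integral_exp_neg_gaussianReal_le {U : ℝ → ℝ} {m : ℝ} {v : ℝ≥0} (hv : v ≠ 0)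
    (hU : ContDiff ℝ 2 U) (hU0 : ∀ y, 0 ≤ U y) (hm : ∀ x, deriv (deriv U) x ≤ m) (x : ℝ) :
    -Real.log (∫ y, Real.exp (-U y) ∂gaussianReal x v)
      ≤ U x + m / 2 * v - v / 2 * (1 - m * v) * deriv U x ^ 2 := by
  set u := deriv U x with hu
  set p := gaussianReal (x - v * u) v with hp
  have hv' : (v : ℝ) ≠ 0 := by exact_mod_cast hv
  set w : ℝ → ℝ := fun y => -U x + v * u ^ 2 / 2 - m / 2 * (y - x) ^ 2 with hw
  have hsq : Integrable (fun y : ℝ => m / 2 * (y - x) ^ 2) p :=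
    (integrable_sub_const_sq_gaussianReal _ _ _).const_mul _
  have hwi : Integrable w p := (integrable_const _).sub hsq
  have htaylor : ∀ y, w y ≤ u * (y - x) + v * u ^ 2 / 2 + -U y := fun y => by
    have := le_add_deriv_mul_add_sq_of_deriv2_le hU hm x y
    simp only [hw, hu]; linarith
  have hdom : Integrable (fun y => Real.exp (u * (y - x) + v * u ^ 2 / 2 + -U y)) p := by
    refine ((integrable_exp_mul_gaussianReal (μ := x - v * u) (v := v) u).const_mul
      (Real.exp (-u * x + v * u ^ 2 / 2))).mono' ?_ (.of_forall fun y => ?_)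
    · have := hU.continuous
      fun_prop
    · rw [Real.norm_of_nonneg (Real.exp_pos _).le, ← Real.exp_add]
      exact Real.exp_le_exp.2 (by linarith [hU0 y])
  have hexp : Integrable (fun y => Real.exp (w y)) p :=
    hdom.mono' (by fun_prop) (.of_forall fun y => by
      rw [Real.norm_of_nonneg (Real.exp_pos _).le]
      exact Real.exp_le_exp.2 (htaylor y))
  have hZ : ∫ y, Real.exp (-U y) ∂gaussianReal x v
      = ∫ y, Real.exp (u * (y - x) + v * u ^ 2 / 2 + -U y) ∂p := by
    rw [integral_gaussianReal_eq_integral_exp x (x - v * u) hv]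
    refine integral_congr_ae (.of_forall fun y => ?_)
    simp only
    rw [← Real.exp_add]
    congr 2
    field_simp
    ring
  have hle : Real.exp (∫ y, w y ∂p) ≤ ∫ y, Real.exp (-U y) ∂gaussianReal x v :=
    (exp_integral_le_integral_exp hwi hexp).trans
      (hZ ▸ integral_mono hexp hdom fun y => Real.exp_le_exp.2 (htaylor y))
  have hint : ∫ y, w y ∂p
      = -U x + v * u ^ 2 / 2 - m / 2 * (v + (x - v * u - x) ^ 2) := by
    simp only [hw]
    rw [integral_sub (integrable_const _) hsq, integral_const_mul, hp,
      integral_sub_const_sq_gaussianReal]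
    simp
  have := (Real.le_log_iff_exp_le ((Real.exp_pos _).trans_le hle)).2 hle
  rw [hint] at this
  linarith

/-- **Drift condition for the diffusion map (dimension one).** If `U : ℝ → [1, ∞)` is `C²`
with `m = sup |U''| < ∞` and satisfies the dissipativity condition
`(1/2) U'(x)² ≥ λ₀ U(x) + m` for `|x| ≥ R`, then for `ε ∈ (0, 1/(4m))` the diffusion map
operator satisfies `T_ε U ≤ (1 - ε λ₀) U + ε b₀ 1_{|x| ≤ R}`, where
`b₀ = m + max_{|x| ≤ R} (λ₀ U(x) - (1/2) U'(x)²)`. -/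
theorem diffusion_map_drift_condition
    (U : ℝ → ℝ) (hU1 : ∀ x, 1 ≤ U x) (hUC2 : ContDiff ℝ 2 U)
    (m : ℝ) (hm : IsLUB (Set.range fun x => |deriv (deriv U) x|) m)
    (lam₀ R : ℝ) (hlam₀ : 0 < lam₀) (hR : 0 < R)
    (hdiss : ∀ x : ℝ, R ≤ |x| → lam₀ * U x + m ≤ (1 / 2) * (deriv U x) ^ 2)
    (ε : ℝ) (hε0 : 0 < ε) (hε : ε < 1 / (4 * m))
    (gε : ℝ → ℝ) (hg : ∀ z, gε z = Real.exp (-z ^ 2 / (4 * ε)))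
    (T : (ℝ → ℝ) → (ℝ → ℝ))
    (hT : ∀ f x, T f x
      = (∫ y, gε (x - y) * Real.exp (-U y) * f y) / (∫ y, gε (x - y) * Real.exp (-U y)))
    (b₀ : ℝ)
    (hb₀ : b₀ = m + sSup ((fun x => lam₀ * U x - (1 / 2) * (deriv U x) ^ 2) '' Set.Icc (-R) R)) :
    ∀ x : ℝ, T U x ≤ (1 - ε * lam₀) * U x + ε * b₀ * Set.indicator {x : ℝ | |x| ≤ R} 1 x := by
  intro x
  have hm0 : 0 < m := by
    by_contra! h
    exact absurd (hε0.trans hε) (not_lt.2 (one_div_nonpos.2 (by linarith)))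
  have hmε : 4 * m * ε < 1 := by
    rw [lt_div_iff₀ (by positivity)] at hε
    linarith
  have hm2 : ∀ z, deriv (deriv U) z ≤ m := fun z =>
    (le_abs_self _).trans (hm.1 (Set.mem_range_self z))
  have hU0 : ∀ z, 0 ≤ U z := fun z => zero_le_one.trans (hU1 z)
  obtain ⟨v, hvε⟩ : ∃ v : NNReal, (v : ℝ) = 2 * ε := ⟨⟨2 * ε, by positivity⟩, rfl⟩
  have hv : v ≠ 0 := fun h => by simp [h] at hvε; linarith
  have hgauss : ∀ f : ℝ → ℝ, ∫ y, f y ∂gaussianReal x v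
      = (√(2 * Real.pi * v))⁻¹ * ∫ y, gε (x - y) * f y := fun f => by
    rw [integral_gaussianReal_eq_integral_smul hv, ← integral_const_mul]
    refine integral_congr_ae (.of_forall fun y => ?_)
    simp only [gaussianPDFReal, smul_eq_mul, hg, hvε]
    rw [mul_assoc, show -(y - x) ^ 2 / (2 * (2 * ε)) = -(x - y) ^ 2 / (4 * ε) by ring]
  have hT' : T U x = (∫ y, Real.exp (-U y) * U y ∂gaussianReal x v)
      / (∫ y, Real.exp (-U y) ∂gaussianReal x v) := by
    have hc : (√(2 * Real.pi * v))⁻¹ ≠ 0 := by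
      rw [hvε]; positivity
    rw [hT, hgauss, hgauss, mul_div_mul_left _ _ hc]
    simp_rw [mul_assoc]
  have hmain : T U x ≤ U x + ε * m - ε / 2 * deriv U x ^ 2 := by
    have h := (integral_exp_neg_mul_div_le_neg_log (P := gaussianReal x v)
      hUC2.continuous.measurable hU0).trans
      (neg_log_integral_exp_neg_gaussianReal_le hv hUC2 hU0 hm2 x)
    rw [← hT', hvε] at h
    nlinarith [mul_nonneg (mul_nonneg hε0.le (sub_nonneg.2 hmε.le)) (sq_nonneg (deriv U x))]
  by_cases hx : |x| ≤ R
  · have hcont : Continuous fun x => lam₀ * U x - (1 / 2) * (deriv U x) ^ 2 := by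
      have := hUC2.continuous
      have := hUC2.continuous_deriv (by norm_num)
      fun_prop
    have hsup := le_csSup (isCompact_Icc.image hcont).bddAbove
      (Set.mem_image_of_mem _ (Set.mem_Icc.2 (abs_le.1 hx)))
    rw [Set.indicator_of_mem (by exact hx), hb₀, Pi.one_apply]
    have := mul_le_mul_of_nonneg_left hsup hε0.le
    linarith
  · rw [Set.indicator_of_notMem (by exact hx)]
    have := mul_le_mul_of_nonneg_left (hdiss x (not_le.1 hx).le) hε0.le
    linarith
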